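/- arXiv:2002.05424 — 2 statements merged into one kernel-verified Lean document; each statement's English description precedes it below -/
import Mathlib

section
/- (Absolutely summable Fourier coefficients imply ILE) Let Y = [−B, B]^d with d ∈ ℕ, B > 0, and let Δ : Y × Y → ℝ be a real-valued function admitting the expansion Δ(y, z) = Σ_{h,k ∈ ℤ^d} Δ̂_{h,k} e^{2πi h·y} e^{2πi k·z} for all y, z ∈ Y, where Δ̂_{h,k} ∈ ℂ and Σ_{h,k ∈ ℤ^d} |Δ̂_{h,k}| < ∞. Then Δ admits an ILE with constant c_Δ ≤ Σ_{h,k ∈ ℤ^d} |Δ̂_{h,k}|. -/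
open RealInnerProductSpace

noncomputable section

/-- An Implicit Loss Embedding (ILE) of the loss `Δ : Z → Y → ℝ` with constant bound `c`:
a separable real Hilbert space `H` together with measurable bounded maps `ψ : Z → H` and
`φ : Y → H` with `‖φ y‖ ≤ 1`, `‖ψ z‖ ≤ c` and `Δ z y = ⟪ψ z, φ y⟫`. -/
structure ILEWith {Z Y : Type*} [MeasurableSpace Z] [MeasurableSpace Y]
    (Δ : Z → Y → ℝ) (c : ℝ) where
  H : Type
  [normgrp : NormedAddCommGroup H]
  [innsp : InnerProductSpace ℝ H]
  [cpl : CompleteSpace H]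
  [sep : TopologicalSpace.SeparableSpace H]
  [mH : MeasurableSpace H]
  [bH : BorelSpace H]
  ψ : Z → H
  φ : Y → H
  meas_ψ : Measurable ψ
  meas_φ : Measurable φ
  norm_φ : ∀ y, ‖φ y‖ ≤ 1
  norm_ψ : ∀ z, ‖ψ z‖ ≤ c
  loss_eq : ∀ z y, Δ z y = ⟪ψ z, φ y⟫

/-- The character `x ↦ exp (2πi h·x)` on Euclidean space. -/
def fourierChar {d : ℕ} (h : Fin d → ℤ) (x : EuclideanSpace ℝ (Fin d)) : ℂ :=
  Complex.exp (2 * Real.pi * Complex.I * ((∑ i, (h i : ℝ) * x i : ℝ) : ℂ))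

lemma norm_fourierChar {d : ℕ} (h : Fin d → ℤ) (x : EuclideanSpace ℝ (Fin d)) :
    ‖fourierChar h x‖ = 1 := by
  rw [fourierChar, Complex.norm_exp]
  simp [-Complex.ofReal_sum, Complex.mul_re]

lemma continuous_fourierChar {d : ℕ} (h : Fin d → ℤ) : Continuous (fourierChar h) := by
  unfold fourierChar
  fun_prop

lemma memℓp_two_of_norm_sq_eq {ι : Type*} {f : ι → ℂ} {g : ι → ℝ} (hg : Summable g)
    (hfg : ∀ i, ‖f i‖ ^ 2 = g i) : Memℓp f 2 :=
  memℓp_gen (by simpa [hfg] using hg)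

lemma norm_sq_eq_tsum_of_lp_two {ι : Type*} (f : lp (fun _ : ι => ℂ) 2) :
    ‖f‖ ^ 2 = ∑' i, ‖f i‖ ^ 2 := by
  simpa using lp.norm_rpow_eq_tsum (p := 2) (by norm_num) f

lemma continuous_lp_two_of_dominated {X ι : Type*} [TopologicalSpace X]
    {f : X → lp (fun _ : ι => ℂ) 2} {g : ι → ℝ} (hg : Summable g)
    (hfg : ∀ x i, ‖f x i‖ ^ 2 = g i) (hf : ∀ i, Continuous fun x => f x i) :
    Continuous f := by
  refine continuous_iff_continuousAt.2 fun w => ?_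
  have hcont : Continuous fun x => ∑' i, ‖f x i - f w i‖ ^ 2 := by
    refine continuous_tsum (u := fun i => 4 * g i)
      (fun i => (((hf i).sub continuous_const).norm).pow 2) (hg.mul_left 4) fun i x => ?_
    rw [Real.norm_of_nonneg (by positivity)]
    have h := pow_le_pow_left₀ (norm_nonneg _) (norm_sub_le (f x i) (f w i)) 2
    nlinarith [sq_nonneg (‖f x i‖ - ‖f w i‖), hfg x i, hfg w i]
  have hnorm : ∀ x, ‖f x - f w‖ = √(∑' i, ‖f x i - f w i‖ ^ 2) := fun x => by
    rw [← Real.sqrt_sq (norm_nonneg (f x - f w)), norm_sq_eq_tsum_of_lp_two]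
    rfl
  rw [ContinuousAt, tendsto_iff_norm_sub_tendsto_zero]
  simp_rw [hnorm]
  simpa using hcont.sqrt.tendsto w

lemma separableSpace_lp_two (ι : Type*) [Countable ι] :
    TopologicalSpace.SeparableSpace (lp (fun _ : ι => ℂ) 2) := by
  let b : HilbertBasis ι ℂ (lp (fun _ : ι => ℂ) 2) := HilbertBasis.ofRepr (.refl ℂ _)
  rw [← TopologicalSpace.isSeparable_univ_iff]
  have h := ((Set.countable_range b).isSeparable.span (R := ℂ)).closure
  rwa [← Submodule.topologicalClosure_coe, b.dense_span, Submodule.top_coe] at h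

/-- a real-valued function on the box `[−B,B]^d × [−B,B]^d` admitting an
absolutely summable double Fourier expansion admits an ILE with constant at most the sum of
the absolute values of the Fourier coefficients. -/
theorem stmt13 {d : ℕ} (B : ℝ) (hB : 0 < B)
    (Δ : {x : EuclideanSpace ℝ (Fin d) // ∀ i, x i ∈ Set.Icc (-B) B} →
         {x : EuclideanSpace ℝ (Fin d) // ∀ i, x i ∈ Set.Icc (-B) B} → ℝ)
    (a : ((Fin d → ℤ) × (Fin d → ℤ)) → ℂ)
    (hsum : Summable fun p => ‖a p‖)
    (hexp : ∀ y z, (Δ y z : ℂ) =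
      ∑' p : (Fin d → ℤ) × (Fin d → ℤ),
        a p * Complex.exp (2 * Real.pi * Complex.I * ((∑ i, (p.1 i : ℝ) * y.1 i : ℝ) : ℂ)) *
          Complex.exp (2 * Real.pi * Complex.I * ((∑ i, (p.2 i : ℝ) * z.1 i : ℝ) : ℂ))) :
    Nonempty (ILEWith Δ (∑' p, ‖a p‖)) := by
  set S := ∑' p, ‖a p‖ with hS
  have hS0 : 0 ≤ S := tsum_nonneg fun _ => norm_nonneg _
  have hsφ : Summable fun p => ‖a p‖ / S := hsum.div_const S
  have hsψ : Summable fun p => ‖a p‖ * S := hsum.mul_right S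
  let φ₀ (z : {x : EuclideanSpace ℝ (Fin d) // ∀ i, x i ∈ Set.Icc (-B) B})
      (p : (Fin d → ℤ) × (Fin d → ℤ)) : ℂ :=
    (√(‖a p‖ / S) : ℝ) * fourierChar p.2 z.1
  let ψ₀ (y : {x : EuclideanSpace ℝ (Fin d) // ∀ i, x i ∈ Set.Icc (-B) B})
      (p : (Fin d → ℤ) × (Fin d → ℤ)) : ℂ :=
    starRingEnd ℂ (a p / (√‖a p‖ : ℝ) * (√S : ℝ) * fourierChar p.1 y.1)
  have hφ₀ : ∀ z p, ‖φ₀ z p‖ ^ 2 = ‖a p‖ / S := fun z p => by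
    simp only [φ₀, norm_mul, norm_fourierChar, mul_one, Complex.norm_real,
      Real.norm_eq_abs, sq_abs]
    exact Real.sq_sqrt (by positivity)
  have hψ₀ : ∀ y p, ‖ψ₀ y p‖ ^ 2 = ‖a p‖ * S := fun y p => by
    simp only [ψ₀, RCLike.norm_conj, norm_mul, norm_div, norm_fourierChar, mul_one,
      Complex.norm_real, Real.norm_of_nonneg (Real.sqrt_nonneg _), Real.div_sqrt]
    rw [mul_pow, Real.sq_sqrt (norm_nonneg _), Real.sq_sqrt hS0]
  have hmul : ∀ y z p, φ₀ z p * starRingEnd ℂ (ψ₀ y p) =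
      a p * fourierChar p.1 y.1 * fourierChar p.2 z.1 := fun y z p => by
    by_cases hp : a p = 0
    · simp [φ₀, ψ₀, hp]
    have hap : 0 < ‖a p‖ := norm_pos_iff.2 hp
    have hSpos : 0 < S := hap.trans_le (hsum.le_tsum p fun _ _ => norm_nonneg _)
    have h₁ : ((√‖a p‖ : ℝ) : ℂ) ≠ 0 := by exact_mod_cast (Real.sqrt_pos.2 hap).ne'
    have h₂ : ((√S : ℝ) : ℂ) ≠ 0 := by exact_mod_cast (Real.sqrt_pos.2 hSpos).ne'
    simp only [φ₀, ψ₀, Complex.conj_conj, Real.sqrt_div (norm_nonneg _), Complex.ofReal_div]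
    field_simp
  let H := lp (fun _ : (Fin d → ℤ) × (Fin d → ℤ) => ℂ) 2
  let φ : _ → H := fun z => ⟨φ₀ z, memℓp_two_of_norm_sq_eq hsφ (hφ₀ z)⟩
  let ψ : _ → H := fun y => ⟨ψ₀ y, memℓp_two_of_norm_sq_eq hsψ (hψ₀ y)⟩
  have hφc : Continuous φ := continuous_lp_two_of_dominated hsφ hφ₀ fun p =>
    continuous_const.mul ((continuous_fourierChar p.2).comp continuous_subtype_val)
  have hψc : Continuous ψ := continuous_lp_two_of_dominated hsψ hψ₀ fun p =>
    Complex.continuous_conj.comp <|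
      continuous_const.mul ((continuous_fourierChar p.1).comp continuous_subtype_val)
  have hφn : ∀ z, ‖φ z‖ ≤ 1 := fun z => by
    have h : ‖φ z‖ ^ 2 = S / S := by
      rw [norm_sq_eq_tsum_of_lp_two, tsum_congr (hφ₀ z), tsum_div_const]
    exact (sq_le_one_iff₀ (norm_nonneg _)).1 (h ▸ div_self_le_one S)
  have hψn : ∀ y, ‖ψ y‖ ≤ S := fun y => by
    have h : ‖ψ y‖ ^ 2 = S * S := by
      rw [norm_sq_eq_tsum_of_lp_two, tsum_congr (hψ₀ y), tsum_mul_right]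
    exact (pow_le_pow_iff_left₀ (norm_nonneg _) hS0 two_ne_zero).1 (h.trans (sq S).symm).le
  have hinner : ∀ y z, inner ℂ (ψ y) (φ z) = (Δ y z : ℂ) := fun y z => by
    rw [lp.inner_eq_tsum, hexp]
    exact tsum_congr fun p => hmul y z p
  let _ : InnerProductSpace ℝ H := InnerProductSpace.rclikeToReal ℂ H
  let _ : MeasurableSpace H := borel H
  have : BorelSpace H := ⟨rfl⟩
  have : TopologicalSpace.SeparableSpace H := separableSpace_lp_two _
  exact ⟨{  H := H
            ψ := ψ
            φ := φ
            meas_ψ := hψc.measurable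
            meas_φ := hφc.measurable
            norm_φ := hφn
            norm_ψ := hψn
            loss_eq := fun y z => by
              rw [real_inner_eq_re_inner ℂ, hinner]
              simp }⟩
end
end

section
/- (Left composition with an everywhere absolutely convergent power series preserves ILE) Let P ∈ ℕ, let Z_p and Y_p be compact Polish spaces and Δ_p : Z_p × Y_p → ℝ admit an ILE for each p = 1, …, P. Let Γ : ℝ^P → ℝ be given by a power series Γ(r₁, …, r_P) = Σ_{t ∈ ℕ^P} a_t ∏_{p=1}^P r_p^{t_p} that converges absolutely for every (r₁, …, r_P) ∈ ℝ^P. Then the function Δ on (Z₁ × ⋯ × Z_P) × (Y₁ × ⋯ × Y_P) defined by Δ(z, y) = Γ(Δ₁(z₁, y₁), …, Δ_P(z_P, y_P)) admits an ILE. -/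
open RealInnerProductSpace

noncomputable section

/-- A loss admits an ILE if it admits an ILE for some constant. -/
def AdmitsILE {Z Y : Type*} [MeasurableSpace Z] [MeasurableSpace Y]
    (Δ : Z → Y → ℝ) : Prop :=
  ∃ c : ℝ, Nonempty (ILEWith Δ c)

/-- A family of measurable coordinate functions whose squares sum to at most `C` at every point:
the coordinates of a measurable map into `ℓ²` with squared norm at most `C`. -/
structure IsCoordMap {ι X : Type*} [MeasurableSpace X] (f : ι → X → ℝ) (C : ℝ) : Prop where
  meas : ∀ i, Measurable (f i)
  summable : ∀ x, Summable fun i => f i x ^ 2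
  tsum_le : ∀ x, ∑' i, f i x ^ 2 ≤ C

namespace IsCoordMap

variable {ι κ X W : Type*} [MeasurableSpace X] [MeasurableSpace W]

theorem comp {f : ι → X → ℝ} {C : ℝ} (hf : IsCoordMap f C) {u : W → X} (hu : Measurable u) :
    IsCoordMap (fun i w => f i (u w)) C :=
  ⟨fun i => (hf.meas i).comp hu, fun w => hf.summable (u w), fun w => hf.tsum_le (u w)⟩

theorem const_one : IsCoordMap (fun (_ : Unit) (_ : X) => (1 : ℝ)) 1 :=
  ⟨fun _ => measurable_const, fun _ => .of_finite, fun _ => by simp⟩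

theorem mul {f : ι → X → ℝ} {g : κ → X → ℝ} {C D : ℝ} (hf : IsCoordMap f C)
    (hg : IsCoordMap g D) : IsCoordMap (fun (k : ι × κ) x => f k.1 x * g k.2 x) (C * D) := by
  have hs (x : X) : Summable fun k : ι × κ => f k.1 x ^ 2 * g k.2 x ^ 2 :=
    (hf.summable x).mul_of_nonneg (hg.summable x) (fun _ => sq_nonneg _) fun _ => sq_nonneg _
  refine ⟨fun k => (hf.meas _).mul (hg.meas _), fun x => by simpa only [mul_pow] using hs x,
    fun x => ?_⟩
  simp only [mul_pow]
  rw [← (hf.summable x).tsum_mul_tsum (hg.summable x) (hs x)]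
  exact mul_le_mul (hf.tsum_le x) (hg.tsum_le x) (tsum_nonneg fun _ => sq_nonneg _)
    ((tsum_nonneg fun _ => sq_nonneg _).trans (hf.tsum_le x))

theorem sigma {T : Type*} {ι : T → Type*} {f : ∀ t, ι t → X → ℝ} {C b : T → ℝ}
    (hf : ∀ t, IsCoordMap (f t) (C t)) (hb : Summable fun t => b t ^ 2 * C t) :
    IsCoordMap (fun (k : Σ t, ι t) x => b k.1 * f k.1 k.2 x) (∑' t, b t ^ 2 * C t) := by
  have hle (t : T) (x : X) : ∑' i, (b t * f t i x) ^ 2 ≤ b t ^ 2 * C t := by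
    simp only [mul_pow, tsum_mul_left]
    exact mul_le_mul_of_nonneg_left ((hf t).tsum_le x) (sq_nonneg _)
  have hin (t : T) (x : X) : Summable fun i => (b t * f t i x) ^ 2 := by
    simpa only [mul_pow] using ((hf t).summable x).mul_left _
  have hout (x : X) : Summable fun t => ∑' i, (b t * f t i x) ^ 2 :=
    hb.of_nonneg_of_le (fun t => tsum_nonneg fun _ => sq_nonneg _) fun t => hle t x
  have hs (x : X) : Summable fun k : Σ t, ι t => (b k.1 * f k.1 k.2 x) ^ 2 :=
    (summable_sigma_of_nonneg fun _ => sq_nonneg _).2 ⟨fun t => hin t x, hout x⟩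
  refine ⟨fun k => ((hf _).meas _).const_mul _, hs, fun x => ?_⟩
  rw [(hs x).tsum_sigma' fun t => hin t x]
  exact (hout x).tsum_le_tsum (fun t => hle t x) hb

theorem summable_mul {f : ι → X → ℝ} {g : ι → W → ℝ} {C D : ℝ} (hf : IsCoordMap f C)
    (hg : IsCoordMap g D) (x : X) (w : W) : Summable fun i => f i x * g i w := by
  refine Summable.of_norm_bounded ((hf.summable x).add (hg.summable w)) fun i => ?_
  rw [Real.norm_eq_abs, abs_le]
  constructor <;> nlinarith [sq_nonneg (f i x + g i w), sq_nonneg (f i x - g i w)]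

/-- A countable coordinate family comes from a measurable map into `ℓ²`. -/
theorem exists_lp [Countable ι] {f : ι → X → ℝ} {C : ℝ} (hf : IsCoordMap f C)
    [TopologicalSpace.SeparableSpace (lp (fun _ : ι => ℝ) 2)]
    [MeasurableSpace (lp (fun _ : ι => ℝ) 2)] [BorelSpace (lp (fun _ : ι => ℝ) 2)] :
    ∃ F : X → lp (fun _ : ι => ℝ) 2, Measurable F ∧ (∀ x i, F x i = f i x) ∧
      ∀ x, ‖F x‖ ^ 2 ≤ C := by
  classical
  have hmem (x : X) : Memℓp (fun i => f i x) 2 := memℓp_gen (by simpa using hf.summable x)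
  refine ⟨fun x => ⟨fun i => f i x, hmem x⟩, ?_, fun _ _ => rfl, fun x => ?_⟩
  · have : SecondCountableTopology (lp (fun _ : ι => ℝ) 2) :=
      UniformSpace.secondCountable_of_separable _
    refine measurable_of_tendsto_metrizable' (Filter.atTop : Filter (Finset ι))
      (f := fun s x => ∑ i ∈ s, f i x • lp.single 2 i (1 : ℝ)) (fun s => ?_) ?_
    · exact Finset.measurable_fun_sum _ fun i _ => (hf.meas i).smul_const _
    · refine tendsto_pi_nhds.2 fun x => ?_
      have := lp.hasSum_single (by simp) (⟨fun i => f i x, hmem x⟩ : lp (fun _ : ι => ℝ) 2)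
      simpa [HasSum, ← lp.single_smul] using this
  · rw [← real_inner_self_eq_norm_sq, lp.inner_eq_tsum]
    simpa [sq] using hf.tsum_le x

end IsCoordMap

theorem Orthonormal.countable_of_separableSpace {ι H : Type*} [NormedAddCommGroup H]
    [InnerProductSpace ℝ H] [TopologicalSpace.SeparableSpace H] {v : ι → H}
    (hv : Orthonormal ℝ v) : Countable ι := by
  have hdisj : (Set.univ : Set ι).PairwiseDisjoint fun i => Metric.ball (v i) (1 / 2) := by
    intro i _ j _ hij
    refine Metric.ball_disjoint_ball ?_
    have h : ‖v i - v j‖ ^ 2 = 2 := by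
      rw [norm_sub_sq_real, hv.1 i, hv.1 j, hv.2 hij]; norm_num
    rw [dist_eq_norm]
    nlinarith [norm_nonneg (v i - v j)]
  exact Set.countable_univ_iff.1 <| hdisj.countable_of_isOpen (fun _ _ => Metric.isOpen_ball)
    fun i _ => ⟨v i, Metric.mem_ball_self (by norm_num)⟩

theorem HilbertBasis.separableSpace {ι H : Type*} [Countable ι] [NormedAddCommGroup H]
    [InnerProductSpace ℝ H] (b : HilbertBasis ι ℝ H) : TopologicalSpace.SeparableSpace H := by
  rw [← TopologicalSpace.isSeparable_univ_iff]
  have h := (Set.countable_range b).isSeparable.span (R := ℝ).closure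
  rwa [← Submodule.topologicalClosure_coe, b.dense_span] at h

/-- `Δ` is a countable sum of products of square-summable measurable coordinates. -/
def HasCoordRep {Z Y : Type*} [MeasurableSpace Z] [MeasurableSpace Y]
    (Δ : Z → Y → ℝ) (C D : ℝ) : Prop :=
  ∃ (ι : Type) (_ : Countable ι) (f : ι → Z → ℝ) (g : ι → Y → ℝ),
    IsCoordMap f C ∧ IsCoordMap g D ∧ ∀ z y, Δ z y = ∑' i, f i z * g i y

namespace HasCoordRep

variable {Z Y : Type*} [MeasurableSpace Z] [MeasurableSpace Y]

theorem comp {Z' Y' : Type*} [MeasurableSpace Z'] [MeasurableSpace Y'] {Δ : Z → Y → ℝ} {C D : ℝ}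
    (h : HasCoordRep Δ C D) {u : Z' → Z} {v : Y' → Y} (hu : Measurable u) (hv : Measurable v) :
    HasCoordRep (fun z y => Δ (u z) (v y)) C D := by
  obtain ⟨ι, hι, f, g, hf, hg, hΔ⟩ := h
  exact ⟨ι, hι, _, _, hf.comp hu, hg.comp hv, fun z y => hΔ _ _⟩

theorem const_one : HasCoordRep (fun (_ : Z) (_ : Y) => (1 : ℝ)) 1 1 :=
  ⟨Unit, inferInstance, _, _, .const_one, .const_one, fun _ _ => by simp⟩

theorem mul {Δ Δ' : Z → Y → ℝ} {C D C' D' : ℝ} (h : HasCoordRep Δ C D)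
    (h' : HasCoordRep Δ' C' D') :
    HasCoordRep (fun z y => Δ z y * Δ' z y) (C * C') (D * D') := by
  obtain ⟨ι, hι, f, g, hf, hg, hΔ⟩ := h
  obtain ⟨κ, hκ, f', g', hf', hg', hΔ'⟩ := h'
  refine ⟨ι × κ, inferInstance, _, _, hf.mul hf', hg.mul hg', fun z y => ?_⟩
  have hs := (hf.mul hf').summable_mul (hg.mul hg') z y
  simp only [mul_mul_mul_comm] at hs ⊢
  rw [hΔ, hΔ', (hf.summable_mul hg z y).tsum_mul_tsum (hf'.summable_mul hg' z y) hs]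

theorem pow {Δ : Z → Y → ℝ} {C D : ℝ} (h : HasCoordRep Δ C D) (n : ℕ) :
    HasCoordRep (fun z y => Δ z y ^ n) (C ^ n) (D ^ n) := by
  induction n with
  | zero => simpa using const_one
  | succ n ih => simpa only [pow_succ] using ih.mul h

theorem prod {α : Type*} {Δ : α → Z → Y → ℝ} {C D : α → ℝ}
    (h : ∀ p, HasCoordRep (Δ p) (C p) (D p)) (s : Finset α) :
    HasCoordRep (fun z y => ∏ p ∈ s, Δ p z y) (∏ p ∈ s, C p) (∏ p ∈ s, D p) := by
  classical
  induction s using Finset.induction_on with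
  | empty => simpa using const_one
  | insert p s hp ih => simpa only [Finset.prod_insert hp] using (h p).mul ih

theorem weighted_tsum {T : Type} [Countable T] {Δ : T → Z → Y → ℝ} {C D a : T → ℝ}
    (h : ∀ t, HasCoordRep (Δ t) (C t) (D t)) (hC : Summable fun t => |a t| * C t)
    (hD : Summable fun t => |a t| * D t) :
    HasCoordRep (fun z y => ∑' t, a t * Δ t z y) (∑' t, |a t| * C t) (∑' t, |a t| * D t) := by
  choose ι hι f g hf hg hΔ using h
  obtain ⟨b, c, hb, hc, hbc⟩ : ∃ b c : T → ℝ, (∀ t, b t ^ 2 = |a t|) ∧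
      (∀ t, c t ^ 2 = |a t|) ∧ ∀ t, b t * c t = a t := by
    refine ⟨fun t => SignType.sign (a t) * √|a t|, fun t => √|a t|, fun t => ?_,
      fun t => Real.sq_sqrt (abs_nonneg _), fun t => ?_⟩
    · rw [mul_pow, Real.sq_sqrt (abs_nonneg _)]
      rcases lt_trichotomy (a t) 0 with h | h | h <;> simp [h]
    · rw [mul_assoc, Real.mul_self_sqrt (abs_nonneg _), sign_mul_abs]
  simp only [← hb] at hC
  simp only [← hc] at hD
  have hF := IsCoordMap.sigma hf hC
  have hG := IsCoordMap.sigma hg hD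
  simp only [hb] at hF
  simp only [hc] at hG
  refine ⟨Σ t, ι t, inferInstance, _, _, hF, hG, fun z y => ?_⟩
  have hs := hF.summable_mul hG z y
  have hterm (t : T) (i : ι t) :
      b t * f t i z * (c t * g t i y) = a t * (f t i z * g t i y) := by
    rw [mul_mul_mul_comm, hbc]
  simp only [hterm] at hs ⊢
  have hin (t : T) : Summable fun i => a t * (f t i z * g t i y) :=
    ((hf t).summable_mul (hg t) z y).mul_left (a t)
  rw [hs.tsum_sigma' hin]
  simp only [tsum_mul_left, hΔ]

theorem admitsILE {Δ : Z → Y → ℝ} {C D : ℝ} (h : HasCoordRep Δ C D) : AdmitsILE Δ := by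
  obtain ⟨ι, hι, f, g, hf, hg, hΔ⟩ := h
  let : MeasurableSpace (lp (fun _ : ι => ℝ) 2) := borel _
  have : BorelSpace (lp (fun _ : ι => ℝ) 2) := ⟨rfl⟩
  have hsep : TopologicalSpace.SeparableSpace (lp (fun _ : ι => ℝ) 2) :=
    HilbertBasis.separableSpace (HilbertBasis.ofRepr (LinearIsometryEquiv.refl ℝ _))
  have : SecondCountableTopology (lp (fun _ : ι => ℝ) 2) :=
    UniformSpace.secondCountable_of_separable _
  obtain ⟨F, hFm, hFf, hFn⟩ := hf.exists_lp
  obtain ⟨G, hGm, hGg, hGn⟩ := hg.exists_lp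
  have hr : 0 < √(|D| + 1) := by positivity
  refine ⟨√(|D| + 1) * √C, ⟨{
    H := lp (fun _ : ι => ℝ) 2
    ψ := fun z => √(|D| + 1) • F z
    φ := fun y => (√(|D| + 1))⁻¹ • G y
    meas_ψ := hFm.const_smul (√(|D| + 1))
    meas_φ := hGm.const_smul (√(|D| + 1))⁻¹
    norm_φ := fun y => ?_
    norm_ψ := fun z => ?_
    loss_eq := fun z y => ?_ }⟩⟩
  · rw [norm_smul, norm_inv, Real.norm_of_nonneg hr.le, inv_mul_le_one₀ hr]
    exact Real.le_sqrt_of_sq_le ((hGn y).trans (by linarith [le_abs_self D]))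
  · rw [norm_smul, Real.norm_of_nonneg hr.le]
    exact mul_le_mul_of_nonneg_left (Real.le_sqrt_of_sq_le (hFn z)) hr.le
  · rw [real_inner_smul_left, real_inner_smul_right, mul_inv_cancel_left₀ hr.ne',
      lp.inner_eq_tsum, hΔ]
    simp [hFf, hGg, mul_comm]

end HasCoordRep

theorem HilbertBasis.isCoordMap {ι H X : Type*} [NormedAddCommGroup H] [InnerProductSpace ℝ H]
    [MeasurableSpace H] [BorelSpace H] [MeasurableSpace X] (b : HilbertBasis ι ℝ H) {u : X → H}
    (hu : Measurable u) {c : ℝ} (hc : ∀ x, ‖u x‖ ≤ c) :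
    IsCoordMap (fun i x => ⟪u x, b i⟫) (c ^ 2) := by
  have hsum (x : X) : HasSum (fun i => ⟪u x, b i⟫ ^ 2) (‖u x‖ ^ 2) := by
    simpa [sq, real_inner_comm] using b.hasSum_inner_mul_inner (u x) (u x)
  refine ⟨fun i => ?_, fun x => (hsum x).summable, fun x => ?_⟩
  · exact (continuous_id.inner continuous_const).measurable.comp hu
  · rw [(hsum x).tsum_eq]
    exact pow_le_pow_left₀ (norm_nonneg _) (hc x) 2

theorem ILEWith.hasCoordRep {Z Y : Type*} [MeasurableSpace Z] [MeasurableSpace Y]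
    {Δ : Z → Y → ℝ} {c : ℝ} (E : ILEWith Δ c) : HasCoordRep Δ (c ^ 2) 1 := by
  obtain ⟨H, ψ, φ, hψ, hφ, nφ, nψ, hΔ⟩ := E
  obtain ⟨w, b, -⟩ := exists_hilbertBasis ℝ H
  have hw : Countable w := b.orthonormal.countable_of_separableSpace
  refine ⟨w, hw, _, _, b.isCoordMap hψ nψ, one_pow (M := ℝ) 2 ▸ b.isCoordMap hφ nφ,
    fun z y => ?_⟩
  rw [hΔ, ← b.tsum_inner_mul_inner]
  simp only [real_inner_comm]

/-- composing finitely many ILE losses on compact Polish spaces with an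
everywhere absolutely convergent power series `Γ` yields an ILE loss on the product
spaces. -/
theorem stmt19 {P : ℕ} (Z Y : Fin P → Type)
    [∀ p, TopologicalSpace (Z p)] [∀ p, PolishSpace (Z p)]
    [∀ p, MeasurableSpace (Z p)] [∀ p, BorelSpace (Z p)] [∀ p, CompactSpace (Z p)]
    [∀ p, TopologicalSpace (Y p)] [∀ p, PolishSpace (Y p)]
    [∀ p, MeasurableSpace (Y p)] [∀ p, BorelSpace (Y p)] [∀ p, CompactSpace (Y p)]
    (Δp : ∀ p, Z p → Y p → ℝ) (hILE : ∀ p, AdmitsILE (Δp p))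
    (a : (Fin P → ℕ) → ℝ)
    (habs : ∀ r : Fin P → ℝ, Summable fun t : Fin P → ℕ => |a t * ∏ p, r p ^ t p|)
    (Γ : (Fin P → ℝ) → ℝ)
    (hΓ : ∀ r : Fin P → ℝ, Γ r = ∑' t : Fin P → ℕ, a t * ∏ p, r p ^ t p) :
    AdmitsILE (fun (z : ∀ p, Z p) (y : ∀ p, Y p) =>
      Γ fun p => Δp p (z p) (y p)) := by
  choose c hc using hILE
  have hrep (p : Fin P) := (hc p).some.hasCoordRep.comp
    (measurable_pi_apply (X := Z) p) (measurable_pi_apply (X := Y) p)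
  have hmon (t : Fin P → ℕ) := HasCoordRep.prod (fun p => (hrep p).pow (t p)) Finset.univ
  have habs' (r : Fin P → ℝ) (hr : ∀ p, 0 ≤ r p) :
      Summable fun t : Fin P → ℕ => |a t| * ∏ p, r p ^ t p := by
    refine (habs r).congr fun t => ?_
    rw [abs_mul, abs_of_nonneg (Finset.prod_nonneg fun p _ => pow_nonneg (hr p) _)]
  have h := HasCoordRep.weighted_tsum (a := a) hmon (habs' _ fun p => sq_nonneg (c p))
    (habs' _ fun _ => zero_le_one)
  simpa only [hΓ] using h.admitsILE
end
end
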